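/- arXiv:2112.05250 — 9 statements merged into one kernel-verified Lean document; each statement's English description precedes it below -/
import Mathlib

section
/- Let E be a finite-dimensional real inner product space and let g, h : E → ℝ be convex. Define the Fenchel conjugates g*(y) = sup_{x∈E}(⟪y,x⟫ − g(x)) and h*(y) = sup_{x∈E}(⟪y,x⟫ − h(x)), with values in ℝ ∪ {+∞}, and assume inf_{x∈E}(g(x) − h(x)) > −∞. Then dom h* = {y : h*(y) < +∞} is nonempty, dom h* ⊆ dom g*, and inf_{x∈E}(g(x) − h(x)) = inf_{y ∈ dom h*}(h*(y) − g*(y)). -/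
open RealInnerProductSpace

/-- The Fenchel conjugate of a real-valued function, with values in `EReal`
(which here only takes values in `ℝ ∪ {+∞}`, as the supremum of a nonempty
family of reals). -/
noncomputable def fenchelConj {E : Type*} [NormedAddCommGroup E] [InnerProductSpace ℝ E]
    (f : E → ℝ) (y : E) : EReal :=
  ⨆ x : E, ((⟪y, x⟫ - f x : ℝ) : EReal)

section FenchelConj

variable {E : Type*} [NormedAddCommGroup E] [InnerProductSpace ℝ E]

lemma inner_sub_le_fenchelConj (f : E → ℝ) (x y : E) :
    ((⟪y, x⟫ - f x : ℝ) : EReal) ≤ fenchelConj f y :=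
  le_iSup (fun x : E => ((⟪y, x⟫ - f x : ℝ) : EReal)) x

lemma fenchelConj_le_coe_iff {f : E → ℝ} {y : E} {b : ℝ} :
    fenchelConj f y ≤ b ↔ ∀ x, ⟪y, x⟫ - f x ≤ b := by
  simp only [fenchelConj, iSup_le_iff, EReal.coe_le_coe_iff]

lemma exists_fenchelConj_eq_coe {f : E → ℝ} {y : E} (hy : fenchelConj f y < ⊤) :
    ∃ b : ℝ, fenchelConj f y = b := by
  have hbot := (EReal.bot_lt_coe _).trans_le (inner_sub_le_fenchelConj f 0 y)
  exact ⟨_, (EReal.coe_toReal hy.ne hbot.ne').symm⟩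

/-- If `g` dominates `h + m`, then the conjugate of `g` is at most that of `h` minus `m`. -/
lemma fenchelConj_le_of_forall_le_sub {g h : E → ℝ} {m b : ℝ} (hm : ∀ x, m ≤ g x - h x)
    {y : E} (hb : fenchelConj h y ≤ b) : fenchelConj g y ≤ ((b - m : ℝ) : EReal) := by
  rw [fenchelConj_le_coe_iff] at hb ⊢
  intro x
  linarith [hb x, hm x]

/-- A finite convex function on a finite-dimensional space has an approximate subgradient at every
point, expressed through its Fenchel conjugate. -/
lemma ConvexOn.exists_fenchelConj_le [FiniteDimensional ℝ E] {f : E → ℝ}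
    (hf : ConvexOn ℝ Set.univ f) (x : E) {a : ℝ} (ha : a < f x) :
    ∃ y, fenchelConj f y ≤ ((⟪y, x⟫ - a : ℝ) : EReal) := by
  obtain ⟨l, c, hle, heq⟩ := hf.exists_affine_le_of_lt (𝕜 := ℝ) (Set.mem_univ x) ha
    isClosed_univ (hf.locallyLipschitz.continuous.lowerSemicontinuous.lowerSemicontinuousOn _)
  refine ⟨(InnerProductSpace.toDual ℝ E).symm l, fenchelConj_le_coe_iff.2 fun z => ?_⟩
  have hz : l z + c ≤ f z := hle ⟨z, Set.mem_univ z⟩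
  have hx : l x + c = a := heq
  simp only [InnerProductSpace.toDual_symm_apply]
  linarith

end FenchelConj

/-- Toland–Singer duality: if `g, h` are convex and `inf (g - h) > -∞`, then
`dom h*` is nonempty, `dom h* ⊆ dom g*`, and
`inf_x (g x - h x) = inf_{y ∈ dom h*} (h* y - g* y)`. -/
theorem toland_singer_duality
    {E : Type*} [NormedAddCommGroup E] [InnerProductSpace ℝ E] [FiniteDimensional ℝ E]
    (g h : E → ℝ) (hg : ConvexOn ℝ Set.univ g) (hh : ConvexOn ℝ Set.univ h)
    (hbdd : BddBelow (Set.range fun x => g x - h x)) :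
    ({y : E | fenchelConj h y < ⊤}).Nonempty ∧
    {y : E | fenchelConj h y < ⊤} ⊆ {y : E | fenchelConj g y < ⊤} ∧
    (⨅ x : E, ((g x - h x : ℝ) : EReal)) =
      ⨅ y ∈ {y : E | fenchelConj h y < ⊤}, (fenchelConj h y - fenchelConj g y) := by
  obtain ⟨m₀, hm₀⟩ := hbdd
  replace hm₀ : ∀ x, m₀ ≤ g x - h x := fun x => hm₀ (Set.mem_range_self x)
  refine ⟨?_, ?_, le_antisymm ?_ ?_⟩
  · obtain ⟨y, hy⟩ := hh.exists_fenchelConj_le 0 (sub_one_lt (h 0))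
    exact ⟨y, hy.trans_lt (EReal.coe_lt_top _)⟩
  · intro y hy
    obtain ⟨b, hb⟩ := exists_fenchelConj_eq_coe hy
    exact (fenchelConj_le_of_forall_le_sub hm₀ hb.le).trans_lt (EReal.coe_lt_top _)
  · refine le_iInf₂ fun y hy => ?_
    obtain ⟨b, hb⟩ := exists_fenchelConj_eq_coe hy
    have hbot : (⨅ x : E, ((g x - h x : ℝ) : EReal)) ≠ ⊥ :=
      ((EReal.bot_lt_coe m₀).trans_le
        (le_iInf fun x => EReal.coe_le_coe_iff.2 (hm₀ x))).ne'
    have htop : (⨅ x : E, ((g x - h x : ℝ) : EReal)) ≠ ⊤ :=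
      ((iInf_le _ (0 : E)).trans_lt (EReal.coe_lt_top _)).ne
    obtain ⟨m, hm⟩ : ∃ m : ℝ, (⨅ x : E, ((g x - h x : ℝ) : EReal)) = m :=
      ⟨_, (EReal.coe_toReal htop hbot).symm⟩
    have hle : ∀ x, m ≤ g x - h x := fun x =>
      EReal.coe_le_coe_iff.1 (hm ▸ iInf_le (fun x : E => ((g x - h x : ℝ) : EReal)) x)
    have hgb := fenchelConj_le_of_forall_le_sub hle hb.le
    obtain ⟨c, hc⟩ := exists_fenchelConj_eq_coe (hgb.trans_lt (EReal.coe_lt_top _))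
    rw [hc, EReal.coe_le_coe_iff] at hgb
    rw [hm, hb, hc, ← EReal.coe_sub, EReal.coe_le_coe_iff]
    linarith
  · refine le_iInf fun x => EReal.le_of_forall_lt_iff_le.1 fun r hr => ?_
    rw [EReal.coe_lt_coe_iff] at hr
    obtain ⟨y, hy⟩ := hh.exists_fenchelConj_le x (show g x - r < h x by linarith)
    refine (iInf₂_le y (hy.trans_lt (EReal.coe_lt_top _))).trans ?_
    refine (EReal.sub_le_sub hy (inner_sub_le_fenchelConj g x y)).trans ?_
    rw [← EReal.coe_sub, EReal.coe_le_coe_iff]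
    linarith
end

section
/- Let E be a finite-dimensional real inner product space and let g, h : E → ℝ be convex with Fenchel conjugates g*, h* : E → ℝ ∪ {+∞}. Suppose x̄ ∈ E and ȳ ∈ ∂g(x̄) ∩ ∂h(x̄), and suppose ȳ solves the dual problem, i.e., h*(ȳ) − g*(ȳ) ≤ h*(y) − g*(y) for every y with h*(y) < +∞ (both conjugates being finite at ȳ). Then x̄ is a global minimizer of g − h on E. -/
open RealInnerProductSpace

/-- A convex function on a finite-dimensional inner product space has a subgradient at every
point. -/
theorem ConvexOn.exists_subgradient {E : Type*} [NormedAddCommGroup E] [InnerProductSpace ℝ E]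
    [FiniteDimensional ℝ E] {f : E → ℝ} (hf : ConvexOn ℝ Set.univ f) (x : E) :
    ∃ y : E, ∀ q : E, f x + ⟪y, q - x⟫ ≤ f q := by
  have hcont : Continuous f := hf.locallyLipschitz.continuous
  have hopen : IsOpen {p : E × ℝ | p.1 ∈ Set.univ ∧ f p.1 < p.2} := by
    simpa using isOpen_lt (hcont.comp continuous_fst) continuous_snd
  obtain ⟨F, hF⟩ := geometric_hahn_banach_point_open (x := (x, f x)) hf.convex_strict_epigraph
    hopen (by simp)
  have hsplit (q : E) (t : ℝ) : F (q, t) = F (q, 0) + t * F (0, 1) := by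
    rw [← smul_eq_mul, ← map_smul, ← map_add]
    simp
  set c := F (0, 1)
  have hlt (q : E) (t : ℝ) (ht : f q < t) : F (x, 0) + f x * c < F (q, 0) + t * c := by
    simpa only [hsplit x (f x), hsplit q t] using hF (q, t) ⟨Set.mem_univ q, ht⟩
  have hc : 0 < c := by linarith [hlt x (f x + 1) (by linarith)]
  let l : StrongDual ℝ E := F.comp (ContinuousLinearMap.inl ℝ E ℝ)
  refine ⟨-c⁻¹ • (InnerProductSpace.toDual ℝ E).symm l, fun q ↦ le_of_forall_gt_imp_ge_of_dense
    fun t ht ↦ ?_⟩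
  have hl : l (q - x) = F (q, 0) - F (x, 0) := by simp [l, ← map_sub]
  rw [real_inner_smul_left, InnerProductSpace.toDual_symm_apply, hl]
  have hdiv : c⁻¹ * (F (x, 0) - F (q, 0)) ≤ t - f x := by
    rw [inv_mul_le_iff₀ hc]
    linarith [hlt q t ht]
  linarith

/-- Equality in the Fenchel-Young inequality at a subgradient. -/
theorem fenchelConj_eq_of_subgradient {E : Type*} [NormedAddCommGroup E] [InnerProductSpace ℝ E]
    {f : E → ℝ} {x y : E} (hy : ∀ q : E, f x + ⟪y, q - x⟫ ≤ f q) :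
    fenchelConj f y = ((⟪y, x⟫ - f x : ℝ) : EReal) := by
  refine le_antisymm (iSup_le fun q ↦ ?_) (le_iSup (fun q ↦ ((⟪y, q⟫ - f q : ℝ) : EReal)) x)
  have hq := hy q
  rw [inner_sub_right] at hq
  exact EReal.coe_le_coe_iff.2 (by linarith)

/-- If `ȳ ∈ ∂g(x̄) ∩ ∂h(x̄)` solves the dual problem of minimizing `h* - g*` over
`dom h*` (both conjugates being finite at `ȳ`), then `x̄` is a global minimizer
of `g - h`. -/
theorem dual_solution_gives_primal_solution
    {E : Type*} [NormedAddCommGroup E] [InnerProductSpace ℝ E] [FiniteDimensional ℝ E]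
    (g h : E → ℝ) (hg : ConvexOn ℝ Set.univ g) (hh : ConvexOn ℝ Set.univ h)
    (xbar ybar : E)
    (hsubg : ∀ q : E, g xbar + ⟪ybar, q - xbar⟫ ≤ g q)
    (hsubh : ∀ q : E, h xbar + ⟪ybar, q - xbar⟫ ≤ h q)
    (hgfin : fenchelConj g ybar < ⊤) (hhfin : fenchelConj h ybar < ⊤)
    (hdual : ∀ y : E, fenchelConj h y < ⊤ →
      fenchelConj h ybar - fenchelConj g ybar ≤ fenchelConj h y - fenchelConj g y) :
    ∀ x : E, g xbar - h xbar ≤ g x - h x := by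
  intro x
  obtain ⟨y, hy⟩ := hh.exists_subgradient x
  have hconj := fenchelConj_eq_of_subgradient hy
  have hle : ((⟪y, x⟫ - g x : ℝ) : EReal) ≤ fenchelConj g y :=
    le_iSup (fun q ↦ ((⟪y, q⟫ - g q : ℝ) : EReal)) x
  have hmin := (hdual y (hconj ▸ EReal.coe_lt_top _)).trans (EReal.sub_le_sub le_rfl hle)
  rw [hconj, fenchelConj_eq_of_subgradient hsubg, fenchelConj_eq_of_subgradient hsubh,
    ← EReal.coe_sub, ← EReal.coe_sub, EReal.coe_le_coe_iff] at hmin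
  linarith
end

section
/- Let E be a real inner product space and let g, h : E → ℝ be functions with g convex. If x* ∈ E is a local minimizer of f = g − h (i.e., there is ε > 0 with g(x) − h(x) ≥ g(x*) − h(x*) for all x with ‖x − x*‖ < ε) and Y ∈ ∂h(x*), then Y ∈ ∂g(x*). Consequently, ∂h(x*) ⊆ ∂g(x*), and if ∂h(x*) is nonempty then x* is a critical point of f in the sense that ∂g(x*) ∩ ∂h(x*) ≠ ∅. -/
open RealInnerProductSpace

/-- A convex function that satisfies the subgradient inequality on a ball around the base point
satisfies it everywhere. -/
theorem ConvexOn.subgradient_of_local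
    {E : Type*} [NormedAddCommGroup E] [InnerProductSpace ℝ E]
    {g : E → ℝ} (hg : ConvexOn ℝ Set.univ g) {x Y : E} {ε : ℝ} (hε : 0 < ε)
    (hloc : ∀ z : E, ‖z - x‖ < ε → g x + ⟪Y, z - x⟫ ≤ g z) (q : E) :
    g x + ⟪Y, q - x⟫ ≤ g q := by
  have hd : 0 ≤ ‖q - x‖ := norm_nonneg _
  obtain ⟨t, ht0, ht1, htε⟩ : ∃ t : ℝ, 0 < t ∧ t ≤ 1 ∧ t * ‖q - x‖ < ε := by
    refine ⟨ε / (ε + ‖q - x‖), by positivity, ?_, ?_⟩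
    · rw [div_le_one (by positivity)]
      linarith
    · rw [div_mul_eq_mul_div, div_lt_iff₀ (by positivity)]
      nlinarith
  have hz : (1 - t) • x + t • q - x = t • (q - x) := by module
  have hlocal := hloc ((1 - t) • x + t • q) (by
    rwa [hz, norm_smul, Real.norm_of_nonneg ht0.le])
  have hconv := hg.2 (Set.mem_univ x) (Set.mem_univ q) (sub_nonneg.2 ht1) ht0.le
    (sub_add_cancel 1 t)
  rw [hz, real_inner_smul_right] at hlocal
  simp only [smul_eq_mul] at hconv
  refine le_of_mul_le_mul_left ?_ ht0
  linarith

/-- Necessary optimality condition for the DC problem: at a local minimizer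
`x*` of `f = g - h` with `g` convex, every subgradient of `h` at `x*` is a
subgradient of `g` at `x*`; hence `∂h(x*) ⊆ ∂g(x*)`, and if `∂h(x*) ≠ ∅` then
`x*` is a critical point, i.e. `∂g(x*) ∩ ∂h(x*) ≠ ∅`. -/
theorem local_min_DC_critical_point
    {E : Type*} [NormedAddCommGroup E] [InnerProductSpace ℝ E]
    (g h : E → ℝ) (hg : ConvexOn ℝ Set.univ g)
    (xstar : E) (ε : ℝ) (hε : 0 < ε)
    (hloc : ∀ x : E, ‖x - xstar‖ < ε → g xstar - h xstar ≤ g x - h x) :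
    (∀ Y : E, (∀ q : E, h xstar + ⟪Y, q - xstar⟫ ≤ h q) →
      (∀ q : E, g xstar + ⟪Y, q - xstar⟫ ≤ g q)) ∧
    ((∃ Y : E, ∀ q : E, h xstar + ⟪Y, q - xstar⟫ ≤ h q) →
      ∃ Y : E, (∀ q : E, g xstar + ⟪Y, q - xstar⟫ ≤ g q) ∧
        (∀ q : E, h xstar + ⟪Y, q - xstar⟫ ≤ h q)) := by
  have hsub : ∀ Y : E, (∀ q : E, h xstar + ⟪Y, q - xstar⟫ ≤ h q) →
      ∀ q : E, g xstar + ⟪Y, q - xstar⟫ ≤ g q := fun Y hY =>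
    hg.subgradient_of_local hε fun z hz => by linarith [hloc z hz, hY z]
  exact ⟨hsub, fun ⟨Y, hY⟩ => ⟨Y, hsub Y hY, hY⟩⟩
end

section
/- Let E be a real inner product space, σ > 0, g : E → ℝ a function, and h : E → ℝ σ-strongly convex. Let x ∈ E, X ∈ ∂h(x), and let x⁺ ∈ E be a global minimizer of the function p ↦ g(p) − ⟪X, p − x⟫. Then g(x⁺) − h(x⁺) ≤ g(x) − h(x) − (σ/2)‖x − x⁺‖². -/
open RealInnerProductSpace

/-- A subgradient of a strongly convex function satisfies the subgradient inequality with an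
additional quadratic term. -/
theorem add_inner_add_sq_le_of_strongConvex
    {E : Type*} [NormedAddCommGroup E] [InnerProductSpace ℝ E] {σ : ℝ} {h : E → ℝ}
    (hh : ∀ x y : E, ∀ t ∈ Set.Icc (0:ℝ) 1,
      h (t • x + (1 - t) • y) ≤ t * h x + (1 - t) * h y - σ / 2 * (t * (1 - t) * ‖x - y‖ ^ 2))
    {x X : E} (hX : ∀ q : E, h x + ⟪X, q - x⟫ ≤ h q) (q : E) :
    h x + ⟪X, q - x⟫ + σ / 2 * ‖q - x‖ ^ 2 ≤ h q := by
  have segment_bound : ∀ t ∈ Set.Ioo (0:ℝ) 1,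
      h x + ⟪X, q - x⟫ + σ / 2 * ((1 - t) * ‖q - x‖ ^ 2) ≤ h q := by
    intro t ht
    have h_sub := hX (t • q + (1 - t) • x)
    rw [show t • q + (1 - t) • x - x = t • (q - x) by module, real_inner_smul_right] at h_sub
    have h_conv := hh q x t ⟨ht.1.le, ht.2.le⟩
    refine le_of_mul_le_mul_left ?_ ht.1
    linarith
  have h_cont : Continuous fun t : ℝ ↦
      h x + ⟪X, q - x⟫ + σ / 2 * ((1 - t) * ‖q - x‖ ^ 2) := by fun_prop
  have h_lim := (h_cont.tendsto 0).mono_left (nhdsWithin_le_nhds (s := Set.Ioi 0))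
  simp only [sub_zero, one_mul] at h_lim
  refine le_of_tendsto h_lim ?_
  filter_upwards [Ioo_mem_nhdsGT one_pos] with t ht using segment_bound t ht

/-- Descent property of one DCA step: if `h` is σ-strongly convex,
`X ∈ ∂h(x)` and `x⁺` minimizes `p ↦ g(p) - ⟪X, p - x⟫`, then
`g(x⁺) - h(x⁺) ≤ g(x) - h(x) - (σ/2)‖x - x⁺‖²`. -/
theorem dca_descent_step
    {E : Type*} [NormedAddCommGroup E] [InnerProductSpace ℝ E]
    (σ : ℝ) (hσ : 0 < σ) (g h : E → ℝ)
    (hh : ∀ x y : E, ∀ t ∈ Set.Icc (0:ℝ) 1,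
      h (t • x + (1 - t) • y) ≤ t * h x + (1 - t) * h y - σ / 2 * (t * (1 - t) * ‖x - y‖ ^ 2))
    (x X xplus : E)
    (hX : ∀ q : E, h x + ⟪X, q - x⟫ ≤ h q)
    (hmin : ∀ p : E, g xplus - ⟪X, xplus - x⟫ ≤ g p - ⟪X, p - x⟫) :
    g xplus - h xplus ≤ g x - h x - σ / 2 * ‖x - xplus‖ ^ 2 := by
  have h_strong := add_inner_add_sq_le_of_strongConvex hh hX xplus
  have h_le := hmin x
  rw [sub_self, inner_zero_right] at h_le
  rw [norm_sub_rev x xplus]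
  linarith
end

section
/- Let E be a real inner product space, σ > 0, g : E → ℝ a function, h : E → ℝ σ-strongly convex, and f = g − h with f_inf := inf_{x∈E} f(x) > −∞. Let (x_k)_{k∈ℕ} ⊆ E and (X_k)_{k∈ℕ} ⊆ E be DCA sequences: X_k ∈ ∂h(x_k) and x_{k+1} is a global minimizer of p ↦ g(p) − ⟪X_k, p − x_k⟫, for every k. Then Σ_{k=0}^{∞} ‖x_k − x_{k+1}‖² ≤ (2/σ)(f(x₀) − f_inf) < +∞, and in particular ‖x_k − x_{k+1}‖ → 0 as k → ∞. -/
open Filter RealInnerProductSpace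

/-- A subgradient of a strongly convex function gives a quadratic lower bound. -/
lemma add_inner_add_sq_le_of_strongly_convex
    {E : Type*} [NormedAddCommGroup E] [InnerProductSpace ℝ E] {σ : ℝ} {h : E → ℝ}
    (hh : ∀ x y : E, ∀ t ∈ Set.Icc (0:ℝ) 1,
      h (t • x + (1 - t) • y) ≤ t * h x + (1 - t) * h y - σ / 2 * (t * (1 - t) * ‖x - y‖ ^ 2))
    {x v : E} (hv : ∀ q : E, h x + ⟪v, q - x⟫ ≤ h q) (q : E) :
    h x + ⟪v, q - x⟫ + σ / 2 * ‖q - x‖ ^ 2 ≤ h q := by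
  have key : ∀ t ∈ Set.Ioo (0:ℝ) 1,
      h x + ⟪v, q - x⟫ + σ / 2 * (1 - t) * ‖q - x‖ ^ 2 ≤ h q := by
    intro t ht
    have h1 := hh q x t ⟨ht.1.le, ht.2.le⟩
    have h2 := hv (t • q + (1 - t) • x)
    have h3 : t • q + (1 - t) • x - x = t • (q - x) := by module
    rw [h3, real_inner_smul_right] at h2
    refine le_of_mul_le_mul_left ?_ ht.1
    linarith
  have hcont : Continuous fun t : ℝ =>
      h x + ⟪v, q - x⟫ + σ / 2 * (1 - t) * ‖q - x‖ ^ 2 := by fun_prop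
  have hlim := (hcont.tendsto 0).mono_left (nhdsWithin_le_nhds (s := Set.Ioi (0:ℝ)))
  have hle := le_of_tendsto hlim
    (eventually_of_mem (Ioo_mem_nhdsGT (zero_lt_one' ℝ)) key)
  simpa using hle

/-- If `c > 0` and `c * a k ≤ u k - u (k + 1)` with `u` bounded below by `m`,
then the partial sums of `a` are bounded by `c⁻¹ * (u 0 - m)`. -/
lemma sum_range_le_of_mul_le_sub {a u : ℕ → ℝ} {c m : ℝ} (hc : 0 < c)
    (hu : ∀ k, m ≤ u k) (hau : ∀ k, c * a k ≤ u k - u (k + 1)) (n : ℕ) :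
    ∑ k ∈ Finset.range n, a k ≤ c⁻¹ * (u 0 - m) := by
  rw [le_inv_mul_iff₀ hc, Finset.mul_sum]
  calc ∑ k ∈ Finset.range n, c * a k
      ≤ ∑ k ∈ Finset.range n, (u k - u (k + 1)) := Finset.sum_le_sum fun k _ => hau k
    _ = u 0 - u n := Finset.sum_range_sub' u n
    _ ≤ u 0 - m := sub_le_sub_left (hu n) _

/-- Square-summability of consecutive DCA steps: with `h` σ-strongly convex and
`f = g - h` bounded below, the DCA iterates satisfy
`Σ ‖x_k - x_{k+1}‖² ≤ (2/σ)(f(x₀) - f_inf) < ∞`, and `‖x_k - x_{k+1}‖ → 0`. -/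
theorem dca_steps_square_summable
    {E : Type*} [NormedAddCommGroup E] [InnerProductSpace ℝ E]
    (σ : ℝ) (hσ : 0 < σ) (g h : E → ℝ)
    (hh : ∀ x y : E, ∀ t ∈ Set.Icc (0:ℝ) 1,
      h (t • x + (1 - t) • y) ≤ t * h x + (1 - t) * h y - σ / 2 * (t * (1 - t) * ‖x - y‖ ^ 2))
    (f : E → ℝ) (hf : ∀ p : E, f p = g p - h p)
    (hbdd : BddBelow (Set.range f))
    (x X : ℕ → E)
    (hXk : ∀ k : ℕ, ∀ q : E, h (x k) + ⟪X k, q - x k⟫ ≤ h q)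
    (hxk : ∀ k : ℕ, ∀ p : E,
      g (x (k+1)) - ⟪X k, x (k+1) - x k⟫ ≤ g p - ⟪X k, p - x k⟫) :
    Summable (fun k : ℕ => ‖x k - x (k+1)‖ ^ 2) ∧
    (∑' k : ℕ, ‖x k - x (k+1)‖ ^ 2) ≤ 2 / σ * (f (x 0) - sInf (Set.range f)) ∧
    Tendsto (fun k : ℕ => ‖x k - x (k+1)‖) atTop (nhds 0) := by
  have hdesc : ∀ k, σ / 2 * ‖x k - x (k+1)‖ ^ 2 ≤ f (x k) - f (x (k+1)) := by
    intro k
    have h1 := add_inner_add_sq_le_of_strongly_convex hh (hXk k) (x (k+1))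
    have h2 := hxk k (x k)
    rw [sub_self, inner_zero_right] at h2
    rw [norm_sub_rev, hf, hf]
    linarith
  have hsum : ∀ n, ∑ k ∈ Finset.range n, ‖x k - x (k+1)‖ ^ 2
      ≤ 2 / σ * (f (x 0) - sInf (Set.range f)) := by
    intro n
    rw [← inv_div σ 2]
    exact sum_range_le_of_mul_le_sub (u := fun k => f (x k)) (half_pos hσ)
      (fun k => csInf_le hbdd (Set.mem_range_self _)) hdesc n
  have hsummable : Summable fun k : ℕ => ‖x k - x (k+1)‖ ^ 2 :=
    summable_of_sum_range_le (fun k => sq_nonneg _) hsum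
  refine ⟨hsummable, Real.tsum_le_of_sum_range_le (fun k => sq_nonneg _) hsum, ?_⟩
  simpa [Real.sqrt_sq] using hsummable.tendsto_atTop_zero.sqrt
end

section
/- Let E be a real inner product space, σ > 0, g : E → ℝ a function, h : E → ℝ σ-strongly convex, and f = g − h with f_inf := inf_{x∈E} f(x) > −∞. Let (x_k), (X_k) be DCA sequences: X_k ∈ ∂h(x_k) and x_{k+1} a global minimizer of p ↦ g(p) − ⟪X_k, p − x_k⟫. Then for every N ∈ ℕ, min_{0 ≤ k ≤ N} ‖x_k − x_{k+1}‖ ≤ ( 2 (f(x₀) − f_inf) / ((N+1) σ) )^{1/2}. -/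
open RealInnerProductSpace

/-- A subgradient of a strongly convex function satisfies the subgradient inequality with an
additional quadratic term. -/
theorem subgradient_add_sq_le {E : Type*} [NormedAddCommGroup E] [InnerProductSpace ℝ E]
    {σ : ℝ} {h : E → ℝ}
    (hh : ∀ x y : E, ∀ t ∈ Set.Icc (0:ℝ) 1,
      h (t • x + (1 - t) • y) ≤ t * h x + (1 - t) * h y - σ / 2 * (t * (1 - t) * ‖x - y‖ ^ 2))
    {x v : E} (hv : ∀ q : E, h x + ⟪v, q - x⟫ ≤ h q) (y : E) :
    h x + ⟪v, y - x⟫ + σ / 2 * ‖y - x‖ ^ 2 ≤ h y := by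
  have scaled : ∀ s : ℝ, 0 ≤ s → s < 1 →
      s * (σ / 2 * ‖y - x‖ ^ 2) ≤ h y - h x - ⟪v, y - x⟫ := by
    intro s hs0 hs1
    have hconv := hh y x (1 - s) ⟨by linarith, by linarith⟩
    have hsub := hv ((1 - s) • y + (1 - (1 - s)) • x)
    have hdiff : (1 - s) • y + (1 - (1 - s)) • x - x = (1 - s) • (y - x) := by module
    rw [hdiff, real_inner_smul_right] at hsub
    refine le_of_mul_le_mul_left ?_ (sub_pos.2 hs1)
    linarith
  by_contra! hlt
  have hnonneg := scaled 0 le_rfl one_pos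
  rw [zero_mul] at hnonneg
  set a := h y - h x - ⟪v, y - x⟫
  set c := σ / 2 * ‖y - x‖ ^ 2
  have hac : a < c := by linarith
  have hc : 0 < c := hnonneg.trans_lt hac
  have hmid := scaled ((a + c) / 2 / c) (by positivity) ((div_lt_one hc).2 (by linarith))
  rw [div_mul_cancel₀ _ hc.ne'] at hmid
  linarith

/-- Iteration complexity of the DCA: for every `N`, the smallest consecutive
step among the first `N+1` satisfies
`min_{0 ≤ k ≤ N} ‖x_k - x_{k+1}‖ ≤ (2 (f(x₀) - f_inf) / ((N+1) σ))^{1/2}`. -/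
theorem dca_iteration_complexity
    {E : Type*} [NormedAddCommGroup E] [InnerProductSpace ℝ E]
    (σ : ℝ) (hσ : 0 < σ) (g h : E → ℝ)
    (hh : ∀ x y : E, ∀ t ∈ Set.Icc (0:ℝ) 1,
      h (t • x + (1 - t) • y) ≤ t * h x + (1 - t) * h y - σ / 2 * (t * (1 - t) * ‖x - y‖ ^ 2))
    (f : E → ℝ) (hf : ∀ p : E, f p = g p - h p)
    (hbdd : BddBelow (Set.range f))
    (x X : ℕ → E)
    (hXk : ∀ k : ℕ, ∀ q : E, h (x k) + ⟪X k, q - x k⟫ ≤ h q)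
    (hxk : ∀ k : ℕ, ∀ p : E,
      g (x (k+1)) - ⟪X k, x (k+1) - x k⟫ ≤ g p - ⟪X k, p - x k⟫) :
    ∀ N : ℕ, ∃ k ≤ N, ‖x k - x (k+1)‖ ≤
      Real.sqrt (2 * (f (x 0) - sInf (Set.range f)) / ((N + 1) * σ)) := by
  intro N
  have decrease : ∀ k, σ / 2 * ‖x k - x (k + 1)‖ ^ 2 ≤ f (x k) - f (x (k + 1)) := by
    intro k
    have hsub := subgradient_add_sq_le hh (hXk k) (x (k + 1))
    have hmin := hxk k (x k)
    rw [sub_self, inner_zero_right] at hmin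
    rw [hf, hf, norm_sub_rev]
    linarith
  have hsum : ∑ k ∈ Finset.range (N + 1), σ / 2 * ‖x k - x (k + 1)‖ ^ 2 ≤
      f (x 0) - sInf (Set.range f) := by
    refine (Finset.sum_le_sum fun k _ => decrease k).trans ?_
    rw [Finset.sum_range_sub' (fun k => f (x k))]
    have := csInf_le hbdd (Set.mem_range_self (x (N + 1)))
    linarith
  have hconst : ∑ _k ∈ Finset.range (N + 1), (f (x 0) - sInf (Set.range f)) / (N + 1) =
      f (x 0) - sInf (Set.range f) := by
    rw [Finset.sum_const, Finset.card_range, nsmul_eq_mul]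
    push_cast
    field_simp
  obtain ⟨k, hk, hle⟩ := Finset.exists_le_of_sum_le Finset.nonempty_range_add_one
    (hsum.trans_eq hconst.symm)
  refine ⟨k, Nat.lt_succ_iff.1 (Finset.mem_range.1 hk), Real.le_sqrt_of_sq_le ?_⟩
  have hN : (0 : ℝ) < N + 1 := by positivity
  rw [le_div_iff₀ hN] at hle
  rw [le_div_iff₀ (by positivity)]
  linarith
end

section
/- Let E be a finite-dimensional real inner product space, g : E → ℝ convex, h : E → ℝ convex, and let (x_k), (X_k) be DCA sequences: X_k ∈ ∂h(x_k) and x_{k+1} is a global minimizer of p ↦ g(p) − ⟪X_k, p − x_k⟫ for every k. Assume moreover that ‖x_k − x_{k+1}‖ → 0. If x̄ ∈ E is a cluster point of (x_k) (i.e., the limit of some subsequence), then there exists a cluster point X̄ of (X_k) such that X̄ ∈ ∂g(x̄) ∩ ∂h(x̄); in particular, every cluster point of (x_k) is a critical point of f = g − h. -/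
open Filter RealInnerProductSpace

/-- Subgradients of `f` at interior points of a set on which `f` is `K`-Lipschitz have norm at most
`K`. -/
theorem norm_subgradient_le_of_lipschitzOnWith
    {E : Type*} [NormedAddCommGroup E] [InnerProductSpace ℝ E]
    {f : E → ℝ} {K : NNReal} {t : Set E} (hf : LipschitzOnWith K f t) {y Y : E}
    (ht : t ∈ nhds y) (hY : ∀ q : E, f y + ⟪Y, q - y⟫ ≤ f q) : ‖Y‖ ≤ K := by
  have hline : Tendsto (fun s : ℝ => y + s • Y) (nhdsWithin 0 (Set.Ioi 0)) (nhds y) := by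
    have hcont : Continuous fun s : ℝ => y + s • Y := by fun_prop
    simpa using (hcont.tendsto 0).mono_left nhdsWithin_le_nhds
  obtain ⟨s, hst, hs⟩ := ((hline.eventually ht).and self_mem_nhdsWithin).exists
  have hs : 0 < s := hs
  have hlip := hf.dist_le_mul _ hst y (mem_of_mem_nhds ht)
  have hsub := hY (y + s • Y)
  rw [add_sub_cancel_left, real_inner_smul_right, real_inner_self_eq_norm_sq] at hsub
  rw [Real.dist_eq, dist_eq_norm, add_sub_cancel_left, norm_smul, Real.norm_of_nonneg hs.le] at hlip
  have habs := le_abs_self (f (y + s • Y) - f y)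
  by_contra! hlt
  have hpos : 0 < ‖Y‖ := K.coe_nonneg.trans_lt hlt
  nlinarith [mul_lt_mul_of_pos_right hlt (mul_pos hs hpos)]

/-- The subdifferential of a continuous function has closed graph. -/
theorem subgradient_of_tendsto
    {E : Type*} [NormedAddCommGroup E] [InnerProductSpace ℝ E]
    {f : E → ℝ} (hf : Continuous f) {y Y : ℕ → E} {ybar Ybar : E}
    (hy : Tendsto y atTop (nhds ybar)) (hY : Tendsto Y atTop (nhds Ybar))
    (hsub : ∀ k : ℕ, ∀ q : E, f (y k) + ⟪Y k, q - y k⟫ ≤ f q) (q : E) :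
    f ybar + ⟪Ybar, q - ybar⟫ ≤ f q :=
  le_of_tendsto' (((hf.tendsto ybar).comp hy).add (hY.inner (tendsto_const_nhds.sub hy)))
    fun k => hsub k q

/-- Subsequential convergence of the DCA to critical points: if `g, h` are
convex, `(x_k), (X_k)` are DCA sequences with `‖x_k - x_{k+1}‖ → 0`, and `x̄` is
a cluster point of `(x_k)`, then some cluster point `X̄` of `(X_k)` satisfies
`X̄ ∈ ∂g(x̄) ∩ ∂h(x̄)`; in particular `x̄` is a critical point of `g - h`. -/
theorem dca_cluster_point_is_critical
    {E : Type*} [NormedAddCommGroup E] [InnerProductSpace ℝ E] [FiniteDimensional ℝ E]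
    (g h : E → ℝ) (hg : ConvexOn ℝ Set.univ g) (hh : ConvexOn ℝ Set.univ h)
    (x X : ℕ → E)
    (hXk : ∀ k : ℕ, ∀ q : E, h (x k) + ⟪X k, q - x k⟫ ≤ h q)
    (hxk : ∀ k : ℕ, ∀ p : E,
      g (x (k+1)) - ⟪X k, x (k+1) - x k⟫ ≤ g p - ⟪X k, p - x k⟫)
    (hstep : Tendsto (fun k : ℕ => ‖x k - x (k+1)‖) atTop (nhds 0))
    (xbar : E) (φ : ℕ → ℕ) (hφ : StrictMono φ)
    (hlim : Tendsto (fun k : ℕ => x (φ k)) atTop (nhds xbar)) :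
    ∃ Xbar : E,
      (∃ ψ : ℕ → ℕ, StrictMono ψ ∧ Tendsto (fun k : ℕ => X (ψ k)) atTop (nhds Xbar)) ∧
      (∀ q : E, g xbar + ⟪Xbar, q - xbar⟫ ≤ g q) ∧
      (∀ q : E, h xbar + ⟪Xbar, q - xbar⟫ ≤ h q) := by
  have hgc : Continuous g := hg.locallyLipschitz.continuous
  have hhl : LocallyLipschitz h := hh.locallyLipschitz
  obtain ⟨K, t, ht, hK⟩ := hhl xbar
  have hbdd : ∀ᶠ k in atTop, X (φ k) ∈ Metric.closedBall (0 : E) K := by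
    filter_upwards [hlim.eventually (eventually_mem_nhds_iff.mpr ht)] with k hk
    rw [mem_closedBall_zero_iff]
    exact norm_subgradient_le_of_lipschitzOnWith hK hk (hXk (φ k))
  obtain ⟨Xbar, -, θ, hθ, hXlim⟩ :=
    tendsto_subseq_of_frequently_bounded Metric.isBounded_closedBall hbdd.frequently
  have hψ : StrictMono (φ ∘ θ) := hφ.comp hθ
  have hxlim : Tendsto (fun k => x (φ (θ k))) atTop (nhds xbar) := hlim.comp hθ.tendsto_atTop
  have hxsucc : Tendsto (fun k => x (φ (θ k) + 1)) atTop (nhds xbar) := by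
    have hdiff := (tendsto_zero_iff_norm_tendsto_zero.mpr hstep).comp hψ.tendsto_atTop
    simpa using hxlim.sub hdiff
  refine ⟨Xbar, ⟨φ ∘ θ, hψ, hXlim⟩, ?_, ?_⟩
  · refine subgradient_of_tendsto hgc hxsucc hXlim fun k q => ?_
    have hmin := hxk (φ (θ k)) q
    simp only [Function.comp_apply, inner_sub_right] at hmin ⊢
    linarith
  · exact subgradient_of_tendsto hhl.continuous hxlim hXlim fun k => hXk (φ (θ k))
end

section
/- Let E be a real inner product space and let g, h : E → ℝ be functions with Fenchel conjugates g*, h* : E → ℝ ∪ {+∞}. Suppose x, x⁺ ∈ E and X ∈ E satisfy: X ∈ ∂h(x), and x⁺ is a global minimizer of p ↦ g(p) − ⟪X, p⟫. Then g*(X) and h*(X) are finite and g(x⁺) − h(x⁺) ≤ h*(X) − g*(X) ≤ g(x) − h(x). -/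
open RealInnerProductSpace

/-- A maximizer of `p ↦ ⟪y, p⟫ - f p` computes the Fenchel conjugate of `f` at `y`. -/
theorem fenchelConj_eq_of_forall_le {E : Type*} [NormedAddCommGroup E] [InnerProductSpace ℝ E]
    {f : E → ℝ} {x y : E} (hx : ∀ p : E, ⟪y, p⟫ - f p ≤ ⟪y, x⟫ - f x) :
    fenchelConj f y = ((⟪y, x⟫ - f x : ℝ) : EReal) :=
  le_antisymm (iSup_le fun p => EReal.coe_le_coe_iff.2 (hx p))
    (le_iSup (fun p : E => ((⟪y, p⟫ - f p : ℝ) : EReal)) x)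

/-- Primal-dual sandwich for one step of the DCA: if `X ∈ ∂h(x)` and `x⁺`
globally minimizes `p ↦ g(p) - ⟪X, p⟫`, then `g*(X)` and `h*(X)` are finite and
`g(x⁺) - h(x⁺) ≤ h*(X) - g*(X) ≤ g(x) - h(x)`. -/
theorem dca_primal_dual_sandwich
    {E : Type*} [NormedAddCommGroup E] [InnerProductSpace ℝ E]
    (g h : E → ℝ) (x xplus X : E)
    (hX : ∀ q : E, h x + ⟪X, q - x⟫ ≤ h q)
    (hmin : ∀ p : E, g xplus - ⟪X, xplus⟫ ≤ g p - ⟪X, p⟫) :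
    fenchelConj g X < ⊤ ∧ fenchelConj h X < ⊤ ∧
    ((g xplus - h xplus : ℝ) : EReal) ≤ fenchelConj h X - fenchelConj g X ∧
    fenchelConj h X - fenchelConj g X ≤ ((g x - h x : ℝ) : EReal) := by
  have hg : fenchelConj g X = ((⟪X, xplus⟫ - g xplus : ℝ) : EReal) :=
    fenchelConj_eq_of_forall_le fun p => by linarith [hmin p]
  have hh : fenchelConj h X = ((⟪X, x⟫ - h x : ℝ) : EReal) :=
    fenchelConj_eq_of_forall_le fun q => by
      have := hX q
      rw [inner_sub_right] at this
      linarith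
  have hXplus := hX xplus
  rw [inner_sub_right] at hXplus
  rw [hg, hh, ← EReal.coe_sub]
  refine ⟨EReal.coe_lt_top _, EReal.coe_lt_top _, EReal.coe_le_coe_iff.2 ?_,
    EReal.coe_le_coe_iff.2 ?_⟩
  · linarith
  · linarith [hmin x]
end

section
/- Let a, b > 0 be real numbers. For p = (p₁, p₂) ∈ ℝ² and X = (X₁, X₂) ∈ ℝ², define the curve γ_{p,X} : ℝ → ℝ² by γ_{p,X}(t) = (p₁ + t X₁, p₂ + t X₂ + t² X₁²). Then for every p and X: (i) the function t ↦ a((p₁ + t X₁)² − (p₂ + t X₂ + t² X₁²))² + 2 (p₁ + t X₁ − b)² is convex on ℝ, and (ii) the function t ↦ (p₁ + t X₁ − b)² is convex on ℝ. -/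
theorem convexOn_sq_add_mul (c d : ℝ) :
    ConvexOn ℝ Set.univ (fun t : ℝ => (c + t * d) ^ 2) := by
  refine ⟨convex_univ, fun x _ y _ u v hu hv huv => ?_⟩
  obtain rfl : v = 1 - u := by linarith
  simp only [smul_eq_mul]
  linarith [mul_nonneg (mul_nonneg hu hv) (sq_nonneg ((x - y) * d))]

/-- Geodesic convexity of the two DC components of the (scaled) Rosenbrock
function along the geodesics `t ↦ (p₁ + t X₁, p₂ + t X₂ + t² X₁²)` of the
metric `G_p = [[1 + 4p₁², −2p₁], [−2p₁, 1]]` on `ℝ²`: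
(i) `t ↦ g(γ(t))` with `g(x) = a(x₁² − x₂)² + 2(x₁ − b)²` is convex, and
(ii) `t ↦ h(γ(t))` with `h(x) = (x₁ − b)²` is convex. -/
theorem rosenbrock_components_geodesically_convex
    (a b : ℝ) (ha : 0 < a) (hb : 0 < b) :
    ∀ p₁ p₂ X₁ X₂ : ℝ,
      ConvexOn ℝ Set.univ (fun t : ℝ =>
        a * ((p₁ + t * X₁) ^ 2 - (p₂ + t * X₂ + t ^ 2 * X₁ ^ 2)) ^ 2 +
          2 * (p₁ + t * X₁ - b) ^ 2) ∧
      ConvexOn ℝ Set.univ (fun t : ℝ => (p₁ + t * X₁ - b) ^ 2) := by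
  intro p₁ p₂ X₁ X₂
  have h : ConvexOn ℝ Set.univ (fun t : ℝ => (p₁ + t * X₁ - b) ^ 2) := by
    simpa only [sub_add_eq_add_sub] using convexOn_sq_add_mul (p₁ - b) X₁
  refine ⟨?_, h⟩
  -- Along a geodesic, `x₁² - x₂` is affine in `t`.
  have hq : ConvexOn ℝ Set.univ (fun t : ℝ =>
      ((p₁ + t * X₁) ^ 2 - (p₂ + t * X₂ + t ^ 2 * X₁ ^ 2)) ^ 2) := by
    convert convexOn_sq_add_mul (p₁ ^ 2 - p₂) (2 * p₁ * X₁ - X₂) using 3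
    ring
  exact (hq.smul ha.le).add (h.smul zero_le_two)
end
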